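/- Let K ≥ 0 be an integer and u ∈ C^{K+2}(ℝ³;ℝ³) with bounded derivatives, ω = ∇×u. For every 0 ≤ k ≤ N−1 define the area-derivative error R^k_{ad} := ∇_{C_{k+1}} × ∇_{C_k} Γ[u,C] + ∫_0^1 ω( a C_k + (1−a)(C_{k-1}+C_{k+1})/2 ) da. Then |D^K_{C_k} R^k_{ad}| ≤ c(K) ‖D^{K+1} ω‖_{L^∞} |C_{k+1} − C_{k-1}|, where c(K) depends only on K. -/

import Mathlib

noncomputable section

open scoped RealInnerProductSpace BigOperators
open MeasureTheory

/-- ℝ³ as a Euclidean space. -/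
abbrev E3 : Type := EuclideanSpace ℝ (Fin 3)

/-- The vector of `E3` with the three given coordinates. -/
def vec3 (a b c : ℝ) : E3 := (WithLp.equiv 2 (Fin 3 → ℝ)).symm ![a, b, c]

/-- Cross product on `E3`. -/
def cross3 (v w : E3) : E3 :=
  vec3 (v 1 * w 2 - v 2 * w 1) (v 2 * w 0 - v 0 * w 2) (v 0 * w 1 - v 1 * w 0)

/-- `j`-th standard basis vector of `E3`. -/
def e3 (j : Fin 3) : E3 := EuclideanSpace.single j 1

/-- Curl (vorticity) of a vector field on `E3`. -/
def curl3 (u : E3 → E3) (x : E3) : E3 :=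
  vec3 (fderiv ℝ u x (e3 1) 2 - fderiv ℝ u x (e3 2) 1)
       (fderiv ℝ u x (e3 2) 0 - fderiv ℝ u x (e3 0) 2)
       (fderiv ℝ u x (e3 0) 1 - fderiv ℝ u x (e3 1) 0)

/-- Divergence of a vector field on `E3`. -/
def div3 (u : E3 → E3) (x : E3) : ℝ := ∑ j : Fin 3, fderiv ℝ u x (e3 j) j

/-- Componentwise Laplacian of a vector field on `E3`. -/
def lap3 (u : E3 → E3) (x : E3) : E3 :=
  ∑ j : Fin 3, fderiv ℝ (fun y => fderiv ℝ u y (e3 j)) x (e3 j)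

/-- Transposed Jacobian of `ω` at `x`, applied to `v`:  `((Dω)ᵀ v)_j = ∑_i ∂_j ω_i v_i`. -/
def jacT (ω : E3 → E3) (x v : E3) : E3 :=
  (WithLp.equiv 2 (Fin 3 → ℝ)).symm fun j => ⟪fderiv ℝ ω x (e3 j), v⟫

/-- Sup norm of the `j`-th derivative of a vector field. -/
def supDeriv (j : ℕ) (u : E3 → E3) : ℝ := ⨆ x : E3, ‖iteratedFDeriv ℝ j u x‖

/-- `C^m` norm: maximum of the sup norms of the derivatives of order `≤ m`. -/
def cNorm (m : ℕ) (u : E3 → E3) : ℝ :=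
  (Finset.range (m + 1)).sup' (Finset.nonempty_range_iff.mpr (Nat.succ_ne_zero m))
    fun j => supDeriv j u

/-- Sobolev `H^K` norm. -/
def sobNorm (K : ℕ) (u : E3 → E3) : ℝ :=
  Real.sqrt (∑ j ∈ Finset.range (K + 1), ∫ x : E3, ‖iteratedFDeriv ℝ j u x‖ ^ 2)

/-- Circulation of `u` along the closed polygon with vertices `C 0, …, C (N-1)`. -/
def circulation (N : ℕ) [NeZero N] (u : E3 → E3) (C : Fin N → E3) : ℝ :=
  ∑ k : Fin N, ∫ a in (0:ℝ)..(1:ℝ), ⟪u ((1 - a) • C k + a • C (k + 1)), C (k + 1) - C k⟫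

/-- `⟨ω⟩` : average of `ω` along the segment joining `(xm+xp)/2` to `y`. -/
def segAvg (ω : E3 → E3) (xm y xp : E3) : E3 :=
  ∫ a in (0:ℝ)..(1:ℝ), ω (a • y + (1 - a) • ((2:ℝ)⁻¹ • (xm + xp)))

variable {N : ℕ}

/-- Partial derivative of a real functional of the vertices with respect to
the `j`-th coordinate of the vertex `k`. -/
def vpdR (k : Fin N) (j : Fin 3) (F : (Fin N → E3) → ℝ) (C : Fin N → E3) : ℝ :=
  fderiv ℝ (fun x => F (Function.update C k x)) (C k) (e3 j)

/-- Gradient of a real functional of the vertices with respect to the vertex `k`. -/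
def vgradR (k : Fin N) (F : (Fin N → E3) → ℝ) (C : Fin N → E3) : E3 :=
  gradient (fun x => F (Function.update C k x)) (C k)

/-- `∇_{C_a} × ∇_{C_b}` applied to a real functional of the vertices. -/
def gradCross (a b : Fin N) (F : (Fin N → E3) → ℝ) (C : Fin N → E3) : E3 :=
  vec3 (vpdR a 1 (vpdR b 2 F) C - vpdR a 2 (vpdR b 1 F) C)
       (vpdR a 2 (vpdR b 0 F) C - vpdR a 0 (vpdR b 2 F) C)
       (vpdR a 0 (vpdR b 1 F) C - vpdR a 1 (vpdR b 0 F) C)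

/-- Migdal's area derivative `(∑_{j>k} ∇_{C_j} + ½ ∇_{C_k}) × ∇_{C_k}` on real functionals. -/
def gradCrossM (k : Fin N) (F : (Fin N → E3) → ℝ) (C : Fin N → E3) : E3 :=
  (∑ j ∈ Finset.univ.filter (fun j : Fin N => (k : ℕ) < (j : ℕ)), gradCross j k F C)
    + (2:ℝ)⁻¹ • gradCross k k F C

/-- Partial derivative of a complex functional of the vertices. -/
def vpd (k : Fin N) (j : Fin 3) (F : (Fin N → E3) → ℂ) (C : Fin N → E3) : ℂ :=
  fderiv ℝ (fun x => F (Function.update C k x)) (C k) (e3 j)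

/-- `∇_{C_a} × ∇_{C_b}` on complex functionals. -/
def opCross (a b : Fin N) (F : (Fin N → E3) → ℂ) (C : Fin N → E3) : Fin 3 → ℂ :=
  ![vpd a 1 (vpd b 2 F) C - vpd a 2 (vpd b 1 F) C,
    vpd a 2 (vpd b 0 F) C - vpd a 0 (vpd b 2 F) C,
    vpd a 0 (vpd b 1 F) C - vpd a 1 (vpd b 0 F) C]

/-- `∇_{C_k} ×` applied to a `ℂ³`-valued functional of the vertices. -/
def vcurl (k : Fin N) (G : (Fin N → E3) → Fin 3 → ℂ) (C : Fin N → E3) : Fin 3 → ℂ :=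
  ![vpd k 1 (fun D => G D 2) C - vpd k 2 (fun D => G D 1) C,
    vpd k 2 (fun D => G D 0) C - vpd k 0 (fun D => G D 2) C,
    vpd k 0 (fun D => G D 1) C - vpd k 1 (fun D => G D 0) C]

/-- Embedding of a real vector into `ℂ³`. -/
def toC3 (v : E3) : Fin 3 → ℂ := fun j => (v j : ℂ)

/-- Bilinear (non-hermitian) dot product on `ℂ³`. -/
def cdot (v w : Fin 3 → ℂ) : ℂ := ∑ j : Fin 3, v j * w j

/-- Bilinear cross product on `ℂ³`. -/
def ccross3 (v w : Fin 3 → ℂ) : Fin 3 → ℂ :=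
  ![v 1 * w 2 - v 2 * w 1, v 2 * w 0 - v 0 * w 2, v 0 * w 1 - v 1 * w 0]

/-- Euclidean magnitude of a vector of `ℂ³`. -/
def cnorm3 (v : Fin 3 → ℂ) : ℝ := Real.sqrt (∑ j : Fin 3, Complex.normSq (v j))

/-- Pairing of a real vector with a complex vector. -/
def dotRC (v : E3) (w : Fin 3 → ℂ) : ℂ := ∑ j : Fin 3, (v j : ℂ) * w j

/-- A smooth cut-off `χ` which is `1` on `B_1(0)` and vanishes outside `B_2(0)`. -/
def IsCutoff (χ : E3 → ℝ) : Prop :=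
  ContDiff ℝ ((⊤ : ℕ∞) : WithTop ℕ∞) χ ∧ (∀ x : E3, ‖x‖ ≤ 1 → χ x = 1) ∧ (∀ x : E3, 2 ≤ ‖x‖ → χ x = 0)

/-- Kernel of the regularized Biot–Savart operator: `∇_y (χ(ℓ(x−y))/|x−y|)`. -/
def BSker (χ : E3 → ℝ) (ℓ : ℝ) (x y : E3) : E3 :=
  gradient (fun z => χ (ℓ • (x - z)) / ‖x - z‖) y

/-- Regularized Biot–Savart operator `BS_ℓ`. -/
def BSreg (χ : E3 → ℝ) (ℓ : ℝ) (ω : E3 → E3) (x : E3) : E3 :=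
  (4 * Real.pi)⁻¹ • ∫ y : E3, cross3 (ω y) (BSker χ ℓ x y)

/-- Regularized Biot–Savart operator on `ℂ³`-valued fields (componentwise). -/
def BSregC (χ : E3 → ℝ) (ℓ : ℝ) (ω : E3 → Fin 3 → ℂ) (x : E3) : Fin 3 → ℂ :=
  (4 * Real.pi)⁻¹ • ∫ y : E3, ccross3 (ω y) (toC3 (BSker χ ℓ x y))

/-- The discretized vorticity operator `Ω_k = (iν/γ) ∇_{C_{k+1}} × ∇_{C_k}`. -/
def vortOp [NeZero N] (γ ν : ℝ) (k : Fin N) (F : (Fin N → E3) → ℂ) (C : Fin N → E3) :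
    Fin 3 → ℂ :=
  (Complex.I * ν / γ) • opCross (k + 1) k F C

/-- The discretized diffusion operator `𝒟_k = 2 ∇_{C_k} × Ω_k`. -/
def diffOp [NeZero N] (γ ν : ℝ) (k : Fin N) (F : (Fin N → E3) → ℂ) (C : Fin N → E3) :
    Fin 3 → ℂ :=
  (2:ℂ) • vcurl k (vortOp γ ν k F) C

/-- The discretized velocity operator `U_k = (1/log(1/ρ)) BS_ℓ ∘ Ω_k`,
with `BS_ℓ` acting in the variable `C_k`. -/
def velOp [NeZero N] (χ : E3 → ℝ) (ℓ ρ γ ν : ℝ) (k : Fin N) (F : (Fin N → E3) → ℂ)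
    (C : Fin N → E3) : Fin 3 → ℂ :=
  (Real.log (1 / ρ))⁻¹ • BSregC χ ℓ (fun x => vortOp γ ν k F (Function.update C k x)) (C k)

/-- Levi-Civita symbol on `Fin 3`. -/
def levi3 (a b c : Fin 3) : ℝ :=
  if (a, b, c) = (0, 1, 2) ∨ (a, b, c) = (1, 2, 0) ∨ (a, b, c) = (2, 0, 1) then 1
  else if (a, b, c) = (2, 1, 0) ∨ (a, b, c) = (1, 0, 2) ∨ (a, b, c) = (0, 2, 1) then -1
  else 0

/-- The discretized advection operator `(Ω_{k+3} × U_k)_α = ε_{αij} Ω^i_{k+3} ∘ U^j_k`. -/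
def advecOp [NeZero N] (χ : E3 → ℝ) (ℓ ρ γ ν : ℝ) (k : Fin N) (F : (Fin N → E3) → ℂ)
    (C : Fin N → E3) : Fin 3 → ℂ :=
  fun α => ∑ i : Fin 3, ∑ j : Fin 3,
    (levi3 α i j : ℂ) * vortOp γ ν (k + 3) (fun D => velOp χ ℓ ρ γ ν k F D j) C i

/-- Migdal's discretized vorticity operator
`Ω^M_k = (iν/γ)(∑_{j=k+1}^{N-1} ∇_{C_j} + ½∇_{C_k}) × ∇_{C_k}`. -/
def vortOpM [NeZero N] (γ ν : ℝ) (k : Fin N) (F : (Fin N → E3) → ℂ) (C : Fin N → E3) :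
    Fin 3 → ℂ :=
  (Complex.I * ν / γ) •
    ((∑ j ∈ Finset.univ.filter (fun j : Fin N => (k : ℕ) < (j : ℕ)), opCross j k F C)
      + (2:ℂ)⁻¹ • opCross k k F C)

/-- Migdal's discretized diffusion operator `𝒟^M_k = 2 ∇_{C_k} × Ω^M_k`. -/
def diffOpM [NeZero N] (γ ν : ℝ) (k : Fin N) (F : (Fin N → E3) → ℂ) (C : Fin N → E3) :
    Fin 3 → ℂ :=
  (2:ℂ) • vcurl k (vortOpM γ ν k F) C

/-- Migdal's discretized velocity operator `U^M_k = (1/log(1/ρ)) BS_ℓ ∘ Ω^M_k`. -/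
def velOpM [NeZero N] (χ : E3 → ℝ) (ℓ ρ γ ν : ℝ) (k : Fin N) (F : (Fin N → E3) → ℂ)
    (C : Fin N → E3) : Fin 3 → ℂ :=
  (Real.log (1 / ρ))⁻¹ • BSregC χ ℓ (fun x => vortOpM γ ν k F (Function.update C k x)) (C k)

/-- The loop functional `Ψ[u,C] = exp((iγ/ν) Γ[u,C])` as a function of the vertices. -/
def loopExp (γ ν : ℝ) (N : ℕ) [NeZero N] (u : E3 → E3) (C : Fin N → E3) : ℂ :=
  Complex.exp (Complex.I * γ / ν * (circulation N u C : ℂ))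

/-- The momentum loop functional `Ψ[P,C](t) = exp((iγ/ν) ∑_k P_k(t)·ΔC_k)`. -/
def momFun (γ ν : ℝ) (N : ℕ) [NeZero N] (P : Fin N → ℝ → Fin 3 → ℂ) (t : ℝ)
    (C : Fin N → E3) : ℂ :=
  Complex.exp (Complex.I * γ / ν * ∑ k : Fin N, cdot (P k t) (toC3 (C (k + 1) - C k)))

/-- The expression `E_k` of the discretized momentum loop equation, as a function of
`ΔP_{k-1}, ΔP_k, ΔP_{k+2}, ΔP_{k+3}` (and of `log N`). -/
def EkDef (γ ν NR : ℝ) (dPm dP dP2 dP3 : Fin 3 → ℂ) : Fin 3 → ℂ :=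
  ((Real.log NR)⁻¹ : ℂ) •
      ((Complex.I * γ / ν) •
        ccross3 (ccross3 dP3 dP2) (dP - (cdot dPm dP / cdot dPm dPm) • dPm))
    + ((2 * γ ^ 2 / ν : ℝ) : ℂ) • (cdot dPm dPm • dP - cdot dPm dP • dPm)

section ParametricIntegral

variable {H F : Type} [NormedAddCommGroup H] [NormedSpace ℝ H]
  [NormedAddCommGroup F] [NormedSpace ℝ F]

/-- Differentiation under the integral sign over `[0, 1]` for an integrand with jointly
continuous derivative. -/
lemma hasFDerivAt_integral_of_continuous [ProperSpace H] {G : H → ℝ → F} {G' : H → ℝ → H →L[ℝ] F}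
    (hG : Continuous (Function.uncurry G)) (hG' : Continuous (Function.uncurry G'))
    (h : ∀ x t, HasFDerivAt (fun x => G x t) (G' x t) x) (x₀ : H) :
    HasFDerivAt (fun x => ∫ t in (0:ℝ)..1, G x t) (∫ t in (0:ℝ)..1, G' x₀ t) x₀ := by
  obtain ⟨M, hM⟩ := ((isCompact_closedBall x₀ 1).prod
    (isCompact_uIcc (a := (0:ℝ)) (b := 1))).exists_bound_of_continuousOn hG'.continuousOn
  have hc : ∀ x, Continuous (G x) := fun x => by
    simpa using! hG.comp (Continuous.prodMk_right x)
  have hc' : ∀ x, Continuous (G' x) := fun x => by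
    simpa using! hG'.comp (Continuous.prodMk_right x)
  refine intervalIntegral.hasFDerivAt_integral_of_dominated_of_fderiv_le (bound := fun _ => M)
    (Metric.closedBall_mem_nhds x₀ one_pos)
    (.of_forall fun x => (hc x).aestronglyMeasurable)
    ((hc x₀).intervalIntegrable _ _) (hc' x₀).aestronglyMeasurable
    (.of_forall fun t ht x hx => hM (x, t) ⟨hx, Set.uIoc_subset_uIcc ht⟩)
    (by simp) (.of_forall fun t _ x _ => h x t)

lemma hasFDerivAt_comp_convexCombination {f : H → F} (hf : ContDiff ℝ 1 f) (p x : H) (a : ℝ) :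
    HasFDerivAt (fun x => f (a • x + (1 - a) • p))
      (a • fderiv ℝ f (a • x + (1 - a) • p)) x := by
  have h1 : HasFDerivAt (fun x : H => a • x + (1 - a) • p)
      (a • ContinuousLinearMap.id ℝ H) x :=
    ((hasFDerivAt_id x).const_smul a).add_const _
  have h2 := ((hf.differentiable one_ne_zero) (a • x + (1 - a) • p)).hasFDerivAt.comp x h1
  exact h2.congr_fderiv (by ext v; simp)

lemma norm_sub_le_of_norm_iteratedFDeriv_one_le {f : H → F} (hf : ContDiff ℝ 1 f) {M : ℝ}
    (hM : ∀ x, ‖iteratedFDeriv ℝ 1 f x‖ ≤ M) (x y : H) : ‖f y - f x‖ ≤ M * ‖y - x‖ :=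
  convex_univ.norm_image_sub_le_of_norm_fderiv_le (𝕜 := ℝ)
    (fun z _ => hf.differentiable one_ne_zero z)
    (fun z _ => by
      rw [← norm_iteratedFDeriv_zero (𝕜 := ℝ) (f := fderiv ℝ f), norm_iteratedFDeriv_fderiv]
      exact hM z) (Set.mem_univ x) (Set.mem_univ y)

/-- The derivatives of the difference of two weighted segment averages with common end point `x`
are controlled by the distance of the other end points. -/
lemma norm_iteratedFDeriv_integral_sub_le [ProperSpace H] (K : ℕ) (p q : H) {M : ℝ} (hM0 : 0 ≤ M) :
    ∀ (F : Type) [NormedAddCommGroup F] [NormedSpace ℝ F] (f : H → F) (w : ℝ → ℝ),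
      Continuous w → (∀ a ∈ Set.Icc (0:ℝ) 1, |w a| ≤ 1) → ContDiff ℝ (K + 1 : ℕ) f →
      (∀ x, ‖iteratedFDeriv ℝ (K + 1) f x‖ ≤ M) → ∀ x,
      ‖iteratedFDeriv ℝ K (fun x => ∫ a in (0:ℝ)..1,
        w a • (f (a • x + (1 - a) • p) - f (a • x + (1 - a) • q))) x‖ ≤ M * ‖p - q‖ := by
  induction K with
  | zero =>
    intro F _ _ f w _ hw1 hf hM x
    rw [norm_iteratedFDeriv_zero]
    have hI : ∀ a ∈ Set.uIoc (0:ℝ) 1,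
        ‖w a • (f (a • x + (1 - a) • p) - f (a • x + (1 - a) • q))‖ ≤ M * ‖p - q‖ := by
      intro a ha
      rw [Set.uIoc_of_le zero_le_one] at ha
      have h1 := norm_sub_le_of_norm_iteratedFDeriv_one_le (by simpa using hf) hM
        (a • x + (1 - a) • q) (a • x + (1 - a) • p)
      have h2 : ‖a • x + (1 - a) • p - (a • x + (1 - a) • q)‖ ≤ ‖p - q‖ := by
        rw [add_sub_add_left_eq_sub, ← smul_sub, norm_smul, Real.norm_eq_abs,
          abs_of_nonneg (by linarith [ha.2])]
        exact mul_le_of_le_one_left (norm_nonneg _) (by linarith [ha.1])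
      rw [norm_smul]
      calc _ ≤ 1 * (M * ‖p - q‖) := by
            gcongr
            · exact hw1 a ⟨ha.1.le, ha.2⟩
            · exact h1.trans (by gcongr)
        _ = _ := one_mul _
    simpa using intervalIntegral.norm_integral_le_of_norm_le_const hI
  | succ K ih =>
    intro F _ _ f w hw hw1 hf hM x
    have hf1 : ContDiff ℝ 1 f := hf.of_le (by norm_cast; omega)
    have hfc : Continuous f := hf1.continuous
    have hdc : Continuous (fderiv ℝ f) := hf1.continuous_fderiv one_ne_zero
    have hd : fderiv ℝ (fun x => ∫ a in (0:ℝ)..1,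
        w a • (f (a • x + (1 - a) • p) - f (a • x + (1 - a) • q))) =
        fun x => ∫ a in (0:ℝ)..1, (w a * a) •
          (fderiv ℝ f (a • x + (1 - a) • p) - fderiv ℝ f (a • x + (1 - a) • q)) := by
      ext1 x
      refine (hasFDerivAt_integral_of_continuous
        (G := fun x a => w a • (f (a • x + (1 - a) • p) - f (a • x + (1 - a) • q)))
        (G' := fun x a => (w a * a) •
          (fderiv ℝ f (a • x + (1 - a) • p) - fderiv ℝ f (a • x + (1 - a) • q)))
        (by unfold Function.uncurry; fun_prop)
        (by unfold Function.uncurry; fun_prop) (fun x a => ?_) x).fderiv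
      have := ((hasFDerivAt_comp_convexCombination hf1 p x a).sub
        (hasFDerivAt_comp_convexCombination hf1 q x a)).const_smul (w a)
      rwa [← smul_sub, smul_smul] at this
    rw [← norm_iteratedFDeriv_fderiv, hd]
    refine ih (H →L[ℝ] F) (fderiv ℝ f) (fun a => w a * a) (by fun_prop) (fun a ha => ?_)
      (hf.fderiv_right (by norm_cast)) (fun x => ?_) x
    · rw [abs_mul, abs_of_nonneg ha.1]
      exact mul_le_one₀ (hw1 a ha) ha.1 ha.2
    · rw [norm_iteratedFDeriv_fderiv]
      exact hM x

end ParametricIntegral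

/-- The curl as a linear function of the Jacobian. -/
def curlCLM : (E3 →L[ℝ] E3) →L[ℝ] E3 :=
  LinearMap.toContinuousLinearMap
    { toFun := fun A => vec3 (A (e3 1) 2 - A (e3 2) 1) (A (e3 2) 0 - A (e3 0) 2)
        (A (e3 0) 1 - A (e3 1) 0)
      map_add' := fun A B => by
        ext i
        fin_cases i <;> simp [vec3] <;> ring
      map_smul' := fun c A => by
        ext i
        fin_cases i <;> simp [vec3] <;> ring }

lemma curl3_eq_comp (u : E3 → E3) : curl3 u = curlCLM ∘ fderiv ℝ u := rfl

lemma contDiff_curl3 {n : ℕ} {u : E3 → E3} (hu : ContDiff ℝ (n + 1 : ℕ) u) :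
    ContDiff ℝ n (curl3 u) := by
  rw [curl3_eq_comp]
  exact curlCLM.contDiff.comp (hu.fderiv_right (by norm_cast))

lemma bddAbove_iteratedFDeriv_curl3 {n : ℕ} {u : E3 → E3} (hu : ContDiff ℝ (n + 1 : ℕ) u)
    {M : ℝ} (hM : ∀ x, ‖iteratedFDeriv ℝ (n + 1) u x‖ ≤ M) :
    BddAbove (Set.range fun x => ‖iteratedFDeriv ℝ n (curl3 u) x‖) := by
  refine ⟨‖curlCLM‖ * M, ?_⟩
  rintro _ ⟨x, rfl⟩
  have h : ContDiff ℝ n (fderiv ℝ u) := hu.fderiv_right (by norm_cast)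
  dsimp only
  rw [curl3_eq_comp]
  refine (curlCLM.norm_iteratedFDeriv_comp_left h.contDiffAt le_rfl).trans ?_
  rw [norm_iteratedFDeriv_fderiv]
  gcongr
  exact hM x

/-- Line integral of `u` along the segment from `p` to `q`. -/
def segCirc (u : E3 → E3) (p q : E3) : ℝ :=
  ∫ a in (0:ℝ)..1, ⟪u ((1 - a) • p + a • q), q - p⟫

/-- Derivative of `segCirc u` in the initial point, in direction `v`. -/
def segCircDeriv (u : E3 → E3) (v p q : E3) : ℝ :=
  ∫ a in (0:ℝ)..1, ((1 - a) * ⟪fderiv ℝ u ((1 - a) • p + a • q) v, q - p⟫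
    - ⟪u ((1 - a) • p + a • q), v⟫)

lemma hasFDerivAt_segCirc_left {u : E3 → E3} (hu : ContDiff ℝ 1 u) (p q : E3) :
    HasFDerivAt (fun x => segCirc u x q) (∫ a in (0:ℝ)..1,
      ((1 - a) • (innerSL ℝ (q - p)).comp (fderiv ℝ u ((1 - a) • p + a • q))
        - innerSL ℝ (u ((1 - a) • p + a • q)))) p := by
  have hc := hu.continuous
  have hd := hu.continuous_fderiv one_ne_zero
  refine hasFDerivAt_integral_of_continuous (by unfold Function.uncurry; fun_prop)
    (G' := fun p a => (1 - a) • (innerSL ℝ (q - p)).comp (fderiv ℝ u ((1 - a) • p + a • q))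
        - innerSL ℝ (u ((1 - a) • p + a • q)))
    (by unfold Function.uncurry; fun_prop) (fun x a => ?_) p
  have h1 : HasFDerivAt (fun x : E3 => (1 - a) • x + a • q)
      ((1 - a) • ContinuousLinearMap.id ℝ E3) x :=
    ((hasFDerivAt_id x).const_smul (1 - a)).add_const _
  have h2 := ((hu.differentiable one_ne_zero) ((1 - a) • x + a • q)).hasFDerivAt.comp x h1
  have h3 := h2.inner ℝ ((hasFDerivAt_id x).const_sub q)
  refine h3.congr_fderiv ?_
  ext v
  simp [fderivInnerCLM_apply, inner_smul_left, inner_sub_right,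
    real_inner_comm]
  ring

lemma fderiv_segCirc_left {u : E3 → E3} (hu : ContDiff ℝ 1 u) (p q v : E3) :
    fderiv ℝ (fun x => segCirc u x q) p v = segCircDeriv u v p q := by
  have hc := hu.continuous
  have hd := hu.continuous_fderiv one_ne_zero
  rw [(hasFDerivAt_segCirc_left hu p q).fderiv, ContinuousLinearMap.intervalIntegral_apply
    (Continuous.intervalIntegrable (by fun_prop) _ _)]
  refine intervalIntegral.integral_congr fun a _ => ?_
  simp [inner_sub_right, real_inner_comm]

lemma segCirc_comm (u : E3 → E3) (p q : E3) : segCirc u p q = -segCirc u q p := by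
  unfold segCirc
  rw [← intervalIntegral.integral_neg]
  have := intervalIntegral.integral_comp_sub_left (a := 0) (b := 1)
    (fun a : ℝ => -⟪u ((1 - a) • q + a • p), p - q⟫) 1
  simp only [sub_self, sub_zero] at this
  rw [← this]
  refine intervalIntegral.integral_congr fun a _ => ?_
  rw [← inner_neg_right, neg_sub, sub_sub_cancel, add_comm]

lemma differentiableAt_segCirc_right {u : E3 → E3} (hu : ContDiff ℝ 1 u) (p q : E3) :
    DifferentiableAt ℝ (fun x => segCirc u p x) q := by
  simp_rw [segCirc_comm u p]
  exact (hasFDerivAt_segCirc_left hu q p).differentiableAt.neg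

lemma fderiv_segCircDeriv {u : E3 → E3} (hu : ContDiff ℝ 2 u) (v w p q : E3) :
    fderiv ℝ (fun y => segCircDeriv u v p y) q w = ∫ a in (0:ℝ)..1,
      ((1 - a) * (a * ⟪fderiv ℝ (fderiv ℝ u) ((1 - a) • p + a • q) w v, q - p⟫
          + ⟪fderiv ℝ u ((1 - a) • p + a • q) v, w⟫)
        - a * ⟪fderiv ℝ u ((1 - a) • p + a • q) w, v⟫) := by
  have hu1 : ContDiff ℝ 1 (fderiv ℝ u) := hu.fderiv_right (by norm_num)
  have hc := hu.continuous
  have hd := hu1.continuous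
  have hdd := hu1.continuous_fderiv one_ne_zero
  have hflip : Continuous fun A : E3 →L[ℝ] E3 →L[ℝ] E3 => A.flip v :=
    ((ContinuousLinearMap.apply ℝ (E3 →L[ℝ] E3) v).continuous).comp
      (ContinuousLinearMap.flipₗᵢ ℝ E3 E3 E3).continuous
  have key : HasFDerivAt (fun y => segCircDeriv u v p y) (∫ a in (0:ℝ)..1,
      ((1 - a) • (a • (innerSL ℝ (q - p)).comp
          ((fderiv ℝ (fderiv ℝ u) ((1 - a) • p + a • q)).flip v)
          + innerSL ℝ (fderiv ℝ u ((1 - a) • p + a • q) v))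
        - a • (innerSL ℝ v).comp (fderiv ℝ u ((1 - a) • p + a • q)))) q := by
    refine hasFDerivAt_integral_of_continuous (by unfold Function.uncurry; fun_prop)
      (G' := fun q a => (1 - a) • (a • (innerSL ℝ (q - p)).comp
          ((fderiv ℝ (fderiv ℝ u) ((1 - a) • p + a • q)).flip v)
          + innerSL ℝ (fderiv ℝ u ((1 - a) • p + a • q) v))
        - a • (innerSL ℝ v).comp (fderiv ℝ u ((1 - a) • p + a • q)))
      ?_ (fun y a => ?_) q
    · have h3 : Continuous fun x : E3 × ℝ =>
          (fderiv ℝ (fderiv ℝ u) ((1 - x.2) • p + x.2 • x.1)).flip v :=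
        hflip.comp (by fun_prop)
      unfold Function.uncurry
      fun_prop
    have h1 : HasFDerivAt (fun y : E3 => (1 - a) • p + a • y)
        (a • ContinuousLinearMap.id ℝ E3) y :=
      ((hasFDerivAt_id y).const_smul a).const_add _
    have h2 := ((hu.differentiable two_ne_zero) ((1 - a) • p + a • y)).hasFDerivAt.comp y h1
    have h3 := ((hu1.differentiable one_ne_zero) ((1 - a) • p + a • y)).hasFDerivAt.comp y h1
    have h4 := ((h3.clm_apply (hasFDerivAt_const v y)).inner ℝ
      ((hasFDerivAt_id y).sub_const p)).const_mul (1 - a)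
    have h5 := h4.sub (h2.inner ℝ (hasFDerivAt_const v y))
    refine h5.congr_fderiv ?_
    ext z
    simp [fderivInnerCLM_apply, inner_smul_left, inner_sub_right,
      real_inner_comm]
    ring
  have hflip' : Continuous fun a : ℝ =>
      (fderiv ℝ (fderiv ℝ u) ((1 - a) • p + a • q)).flip v :=
    hflip.comp (by fun_prop)
  rw [key.fderiv, ContinuousLinearMap.intervalIntegral_apply
    (Continuous.intervalIntegrable (by fun_prop) _ _)]
  refine intervalIntegral.integral_congr fun a _ => ?_
  simp [inner_sub_right, real_inner_comm]
  ring

section Polygon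

variable [NeZero N]

lemma Fin.one_ne_zero_of_three_le (hN : 3 ≤ N) : (1 : Fin N) ≠ 0 := by
  obtain ⟨n, rfl⟩ := Nat.exists_eq_add_of_le' hN
  simp

lemma Fin.one_add_one_ne_zero_of_three_le (hN : 3 ≤ N) : (1 : Fin N) + 1 ≠ 0 := by
  obtain ⟨n, rfl⟩ := Nat.exists_eq_add_of_le' hN
  simp [Fin.ext_iff, Fin.val_add, Nat.mod_eq_of_lt]

lemma circulation_update (hN : 3 ≤ N) (u : E3 → E3) (C : Fin N → E3) (k : Fin N) (x : E3) :
    circulation N u (Function.update C k x) =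
      segCirc u x (C (k + 1)) + segCirc u (C (k - 1)) x
        + ∑ m ∈ (Finset.univ.erase k).erase (k - 1), segCirc u (C m) (C (m + 1)) := by
  have h1 := Fin.one_ne_zero_of_three_le hN
  have hk : k - 1 ≠ k := by simpa using h1
  have hk' : k + 1 ≠ k := by simpa using h1
  have hs : circulation N u (Function.update C k x) =
      ∑ m, segCirc u (Function.update C k x m) (Function.update C k x (m + 1)) := rfl
  rw [hs, ← Finset.add_sum_erase _ _ (Finset.mem_univ k),
    ← Finset.add_sum_erase _ _ (Finset.mem_erase.2 ⟨hk, Finset.mem_univ (k - 1)⟩), ← add_assoc]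
  congr 1
  · simp [hk, hk']
  · refine Finset.sum_congr rfl fun m hm => ?_
    simp only [Finset.mem_erase, Finset.mem_univ, and_true] at hm
    rw [Function.update_of_ne hm.2, Function.update_of_ne]
    exact fun h => hm.1 (eq_sub_of_add_eq h)

lemma vpdR_circulation (hN : 3 ≤ N) {u : E3 → E3} (hu : ContDiff ℝ 1 u) (C : Fin N → E3)
    (k : Fin N) (j : Fin 3) :
    vpdR k j (circulation N u) C = segCircDeriv u (e3 j) (C k) (C (k + 1))
      + fderiv ℝ (fun x => segCirc u (C (k - 1)) x) (C k) (e3 j) := by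
  unfold vpdR
  simp_rw [circulation_update hN]
  rw [fderiv_add_const, fderiv_fun_add (hasFDerivAt_segCirc_left hu _ _).differentiableAt
    (differentiableAt_segCirc_right hu _ _), add_apply,
    fderiv_segCirc_left hu]

lemma vpdR_vpdR_circulation (hN : 3 ≤ N) {u : E3 → E3} (hu : ContDiff ℝ 2 u) (C : Fin N → E3)
    (k : Fin N) (i j : Fin 3) :
    vpdR (k + 1) i (vpdR k j (circulation N u)) C =
      fderiv ℝ (fun y => segCircDeriv u (e3 j) (C k) y) (C (k + 1)) (e3 i) := by
  have h1 : k ≠ k + 1 := by simpa using Fin.one_ne_zero_of_three_le hN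
  have h2 : k - 1 ≠ k + 1 := fun h =>
    Fin.one_add_one_ne_zero_of_three_le hN (by
      rw [sub_eq_iff_eq_add, add_assoc] at h
      simpa using h)
  unfold vpdR
  have := vpdR_circulation hN (hu.of_le one_le_two)
  unfold vpdR at this
  simp_rw [this, Function.update_self, Function.update_of_ne h1, Function.update_of_ne h2]
  rw [fderiv_add_const]

/-- The antisymmetrized mixed vertex derivatives of the circulation only see the
antisymmetric part of the Jacobian. -/
lemma vpdR_circulation_antisymm (hN : 3 ≤ N) {u : E3 → E3} (hu : ContDiff ℝ 2 u)
    (C : Fin N → E3) (k : Fin N) (i j : Fin 3) :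
    vpdR (k + 1) i (vpdR k j (circulation N u)) C
        - vpdR (k + 1) j (vpdR k i (circulation N u)) C =
      ∫ a in (0:ℝ)..1, (fderiv ℝ u ((1 - a) • C k + a • C (k + 1)) (e3 j) i
        - fderiv ℝ u ((1 - a) • C k + a • C (k + 1)) (e3 i) j) := by
  have hu1 : ContDiff ℝ 1 (fderiv ℝ u) := hu.fderiv_right (by norm_num)
  have hd := hu1.continuous
  have hdd := hu1.continuous_fderiv one_ne_zero
  rw [vpdR_vpdR_circulation hN hu, vpdR_vpdR_circulation hN hu, fderiv_segCircDeriv hu,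
    fderiv_segCircDeriv hu, ← intervalIntegral.integral_sub
      (Continuous.intervalIntegrable (by fun_prop) _ _)
      (Continuous.intervalIntegrable (by fun_prop) _ _)]
  refine intervalIntegral.integral_congr fun a _ => ?_
  have hsymm := (hu.contDiffAt (x := (1 - a) • C k + a • C (k + 1))).isSymmSndFDerivAt
    (by simp) (e3 i) (e3 j)
  have he : ∀ (v : E3) (m : Fin 3), ⟪v, e3 m⟫ = v m := fun v m => by
    simp [e3, EuclideanSpace.inner_single_right]
  simp only [hsymm, he]
  ring

lemma gradCross_circulation (hN : 3 ≤ N) {u : E3 → E3} (hu : ContDiff ℝ 2 u) (C : Fin N → E3)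
    (k : Fin N) :
    gradCross (k + 1) k (circulation N u) C =
      -∫ a in (0:ℝ)..1, curl3 u (a • C k + (1 - a) • C (k + 1)) := by
  have hc : Continuous (curl3 u) := (contDiff_curl3 (n := 1) hu).continuous
  have hswap := intervalIntegral.integral_comp_sub_left (a := 0) (b := 1)
    (fun a : ℝ => curl3 u ((1 - a) • C k + a • C (k + 1))) 1
  simp only [sub_self, sub_zero, sub_sub_cancel] at hswap
  have hproj : ∀ i : Fin 3, (∫ a in (0:ℝ)..1, curl3 u ((1 - a) • C k + a • C (k + 1))) i =
      ∫ a in (0:ℝ)..1, curl3 u ((1 - a) • C k + a • C (k + 1)) i := fun i =>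
    ((EuclideanSpace.proj (𝕜 := ℝ) i : E3 →L[ℝ] ℝ).intervalIntegral_comp_comm
      (Continuous.intervalIntegrable (by fun_prop) _ _)).symm
  rw [hswap]
  ext i
  rw [PiLp.neg_apply, hproj, ← intervalIntegral.integral_neg]
  unfold gradCross
  simp_rw [vpdR_circulation_antisymm hN hu]
  fin_cases i <;>
  · simp only [vec3, curl3, WithLp.equiv_symm_apply]
    refine intervalIntegral.integral_congr fun a _ => ?_
    simp

end Polygon

/-! ## Statement 2 -/
theorem stmt_2 (K : ℕ) :
    ∃ cK > (0:ℝ),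
      ∀ (N : ℕ) [NeZero N], 3 ≤ N →
      ∀ u : E3 → E3, ContDiff ℝ (K + 2 : ℕ) u →
      (∀ j ≤ K + 2, ∃ M, ∀ x, ‖iteratedFDeriv ℝ j u x‖ ≤ M) →
      ∀ (C : Fin N → E3) (k : Fin N),
        ‖iteratedFDeriv ℝ K
            (fun x =>
              gradCross (k + 1) k (circulation N u) (Function.update C k x)
                + segAvg (curl3 u) (C (k - 1)) x (C (k + 1)))
            (C k)‖
          ≤ cK * supDeriv (K + 1) (curl3 u) * ‖C (k + 1) - C (k - 1)‖ := by
  refine ⟨1, one_pos, fun N _ hN u hu hb C k => ?_⟩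
  obtain ⟨M, hM⟩ := hb (K + 2) le_rfl
  have hω : ContDiff ℝ (K + 1 : ℕ) (curl3 u) := contDiff_curl3 hu
  have hbdd := bddAbove_iteratedFDeriv_curl3 (n := K + 1) hu hM
  have hS : ∀ x, ‖iteratedFDeriv ℝ (K + 1) (curl3 u) x‖ ≤ supDeriv (K + 1) (curl3 u) :=
    fun x => le_ciSup hbdd x
  have hS0 : 0 ≤ supDeriv (K + 1) (curl3 u) := (norm_nonneg _).trans (hS 0)
  have hc := hω.continuous
  have hk : k + 1 ≠ k := by simpa using Fin.one_ne_zero_of_three_le hN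
  have hR : (fun x => gradCross (k + 1) k (circulation N u) (Function.update C k x)
        + segAvg (curl3 u) (C (k - 1)) x (C (k + 1))) =
      fun x => ∫ a in (0:ℝ)..1, (1:ℝ) •
        (curl3 u (a • x + (1 - a) • ((2:ℝ)⁻¹ • (C (k - 1) + C (k + 1))))
          - curl3 u (a • x + (1 - a) • C (k + 1))) := by
    ext1 x
    simp only [one_smul]
    rw [gradCross_circulation hN (hu.of_le (by norm_cast; omega)), Function.update_self,
      Function.update_of_ne hk, intervalIntegral.integral_sub
        (Continuous.intervalIntegrable (by fun_prop) _ _)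
        (Continuous.intervalIntegrable (by fun_prop) _ _), neg_add_eq_sub, segAvg]
  rw [hR]
  refine (norm_iteratedFDeriv_integral_sub_le K _ _ hS0 E3 (curl3 u) (fun _ => 1)
    continuous_const (by simp) hω hS (C k)).trans ?_
  have hmid : (2:ℝ)⁻¹ • (C (k - 1) + C (k + 1)) - C (k + 1) =
      (2:ℝ)⁻¹ • (C (k - 1) - C (k + 1)) := by
    module
  rw [one_mul, hmid, norm_smul, norm_sub_rev (C (k + 1))]
  gcongr
  exact mul_le_of_le_one_left (norm_nonneg _) (by norm_num)

end
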